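/- Let n ≥ 1 and consider the symbol error rate of a decoder with center-convex decision regions as a function of the noise power v > 0 in the AWGN channel: P_e(v) = 1 − Σ_{i=1}^{M} q_i ∫_{Ω_i} (2πv)^{−n/2} exp(−‖x‖²/(2v)) dx. If Metric.closedBall 0 d_min ⊆ Ω_i for every i with d_min > 0, then P_e is convex on the interval (0, d_min²/(n+2)]. If Ω_i ⊆ Metric.closedBall 0 d_max for every i with d_max > 0, then P_e is concave on the interval [d_max²/(n+2), ∞). -/

import Mathlib

open MeasureTheory Real Set

theorem ConvexOn.integral_param {α : Type*} [MeasurableSpace α] {μ : Measure α} {s : Set ℝ}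
    {f : α → ℝ → ℝ} (hs : Convex ℝ s) (hf : ∀ a, ConvexOn ℝ s (f a))
    (hint : ∀ v ∈ s, Integrable (fun a => f a v) μ) :
    ConvexOn ℝ s (fun v => ∫ a, f a v ∂μ) := by
  refine ⟨hs, fun x hx y hy a b ha hb hab => ?_⟩
  simp only [smul_eq_mul]
  rw [← integral_const_mul, ← integral_const_mul,
    ← integral_add ((hint x hx).const_mul a) ((hint y hy).const_mul b)]
  refine integral_mono (hint _ (hs hx hy ha hb hab))
    (((hint x hx).const_mul a).add ((hint y hy).const_mul b)) fun c => ?_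
  exact (hf c).2 hx hy ha hb hab

theorem ConcaveOn.integral_param {α : Type*} [MeasurableSpace α] {μ : Measure α} {s : Set ℝ}
    {f : α → ℝ → ℝ} (hs : Convex ℝ s) (hf : ∀ a, ConcaveOn ℝ s (f a))
    (hint : ∀ v ∈ s, Integrable (fun a => f a v) μ) :
    ConcaveOn ℝ s (fun v => ∫ a, f a v ∂μ) := by
  have h := ConvexOn.integral_param hs (fun a => (hf a).neg) (fun v hv => (hint v hv).neg)
  refine neg_convexOn_iff.1 (h.congr fun v _ => ?_)
  simp [integral_neg]

section Polar

variable {E : Type*} [NormedAddCommGroup E] [NormedSpace ℝ E] [MeasurableSpace E]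
  (μ : Measure E) [FiniteDimensional ℝ E] [BorelSpace E] [μ.IsAddHaarMeasure]

theorem integral_volumeIoiPow (k : ℕ) (f : ℝ → ℝ) :
    ∫ r : Ioi (0 : ℝ), f r ∂Measure.volumeIoiPow k = ∫ r in Ioi (0 : ℝ), r ^ k * f r := by
  simp only [Measure.volumeIoiPow, ENNReal.ofReal]
  rw [integral_withDensity_eq_integral_smul,
    integral_subtype_comap measurableSet_Ioi fun a ↦ Real.toNNReal (a ^ k) • f a,
    setIntegral_congr_fun measurableSet_Ioi fun x hx ↦ ?_]
  · rw [NNReal.smul_def, Real.coe_toNNReal _ (pow_nonneg hx.out.le _), smul_eq_mul]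
  · exact (measurable_subtype_coe.pow_const _).real_toNNReal

theorem integrable_polar {f : E → ℝ} (hf : Integrable f μ) :
    Integrable (fun p : Metric.sphere (0 : E) 1 × Ioi (0 : ℝ) => f (p.2.1 • p.1.1))
      (μ.toSphere.prod (Measure.volumeIoiPow (Module.finrank ℝ E - 1))) := by
  rw [← μ.measurePreserving_homeomorphUnitSphereProd.integrable_comp_emb
    (Homeomorph.measurableEmbedding _)]
  have h : ((fun p : Metric.sphere (0 : E) 1 × Ioi (0 : ℝ) => f (p.2.1 • p.1.1)) ∘
      homeomorphUnitSphereProd E) = f ∘ ((↑) : ({0}ᶜ : Set E) → E) := by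
    ext x
    have hx : ‖x.1‖ ≠ 0 := norm_ne_zero_iff.2 x.2
    simp [smul_smul, hx]
  rw [h, ← integrableOn_iff_comap_subtypeVal (by measurability)]
  exact hf.integrableOn

theorem integral_polar [Nontrivial E] {f : E → ℝ} (hf : Integrable f μ) :
    ∫ x, f x ∂μ = ∫ θ : Metric.sphere (0 : E) 1, (∫ r in Ioi (0 : ℝ),
      r ^ (Module.finrank ℝ E - 1) * f (r • θ.1)) ∂μ.toSphere := by
  calc
    ∫ x, f x ∂μ = ∫ x : ({(0)}ᶜ : Set E), f x.1 ∂(μ.comap (↑)) := by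
      rw [integral_subtype_comap (measurableSet_singleton _).compl f,
        restrict_compl_singleton]
    _ = ∫ p, f (p.2.1 • p.1.1) ∂μ.toSphere.prod
          (.volumeIoiPow (Module.finrank ℝ E - 1)) := by
      rw [← μ.measurePreserving_homeomorphUnitSphereProd.integral_comp
        (Homeomorph.measurableEmbedding _)]
      refine integral_congr_ae (.of_forall fun x => ?_)
      have hx : ‖x.1‖ ≠ 0 := norm_ne_zero_iff.2 x.2
      simp [smul_smul, hx]
    _ = _ := by
      rw [integral_prod _ (integrable_polar μ hf)]
      exact integral_congr_ae (.of_forall fun θ =>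
        integral_volumeIoiPow _ fun r => f (r • θ.1))

theorem integrable_integral_ray {f : E → ℝ} (hf : Integrable f μ) :
    Integrable (fun θ : Metric.sphere (0 : E) 1 => ∫ r in Ioi (0 : ℝ),
      r ^ (Module.finrank ℝ E - 1) * f (r • θ.1)) μ.toSphere := by
  refine (integrable_polar μ hf).integral_prod_left.congr (.of_forall fun θ => ?_)
  exact integral_volumeIoiPow _ fun r => f (r • θ.1)

end Polar

/-- The Gaussian density of variance `v` on `ℝⁿ` as a function of the radius. -/
noncomputable def gaussianProfile (n : ℕ) (v r : ℝ) : ℝ :=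
  (2 * π * v) ^ (-(n : ℝ) / 2) * Real.exp (-r ^ 2 / (2 * v))

/-- The unnormalised incomplete radial Gaussian integral. -/
noncomputable def radialGaussian (m : ℕ) (y : ℝ) : ℝ :=
  ∫ s in (0 : ℝ)..y, s ^ m * Real.exp (-s ^ 2 / 2)

theorem pow_mul_gaussianProfile {m : ℕ} {v : ℝ} (hv : 0 < v) (r : ℝ) :
    r ^ m * gaussianProfile (m + 1) v r = (2 * π) ^ (-((m + 1 : ℕ) : ℝ) / 2) *
      (v ^ (-1 / 2 : ℝ) * ((v ^ (-1 / 2 : ℝ) * r) ^ m *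
        Real.exp (-(v ^ (-1 / 2 : ℝ) * r) ^ 2 / 2))) := by
  have h1 : (v ^ (-1 / 2 : ℝ)) ^ 2 = v⁻¹ := by
    rw [← rpow_natCast, ← rpow_mul hv.le, ← rpow_neg_one]; norm_num
  have h2 : v ^ (-((m + 1 : ℕ) : ℝ) / 2) = (v ^ (-1 / 2 : ℝ)) ^ (m + 1) := by
    rw [← rpow_natCast, ← rpow_mul hv.le]; congr 1; ring
  have h3 : -r ^ 2 / (2 * v) = -(v ^ (-1 / 2 : ℝ) * r) ^ 2 / 2 := by
    rw [mul_pow, h1]; field_simp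
  rw [gaussianProfile, mul_rpow (by positivity) hv.le, h2, h3]
  ring

theorem integral_Ioc_gaussianProfile {m : ℕ} {v R : ℝ} (hv : 0 < v) (hR : 0 ≤ R) :
    ∫ r in Ioc 0 R, r ^ m * gaussianProfile (m + 1) v r =
      (2 * π) ^ (-((m + 1 : ℕ) : ℝ) / 2) * radialGaussian m (R * v ^ (-1 / 2 : ℝ)) := by
  have hc : v ^ (-1 / 2 : ℝ) ≠ 0 := (rpow_pos_of_pos hv _).ne'
  simp_rw [pow_mul_gaussianProfile hv, integral_const_mul]
  rw [← intervalIntegral.integral_of_le hR,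
    intervalIntegral.integral_comp_mul_left (fun s => s ^ m * Real.exp (-s ^ 2 / 2)) hc,
    radialGaussian, smul_eq_mul, mul_inv_cancel_left₀ hc, mul_zero, mul_comm R]

theorem integral_Ioi_gaussianProfile {m : ℕ} {v : ℝ} (hv : 0 < v) :
    ∫ r in Ioi 0, r ^ m * gaussianProfile (m + 1) v r =
      (2 * π) ^ (-((m + 1 : ℕ) : ℝ) / 2) *
        ∫ s in Ioi (0 : ℝ), s ^ m * Real.exp (-s ^ 2 / 2) := by
  have hc : 0 < v ^ (-1 / 2 : ℝ) := rpow_pos_of_pos hv _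
  simp_rw [pow_mul_gaussianProfile hv, integral_const_mul]
  rw [integral_comp_mul_left_Ioi (fun s => s ^ m * Real.exp (-s ^ 2 / 2)) 0 hc,
    smul_eq_mul, mul_inv_cancel_left₀ hc.ne', mul_zero]

theorem hasDerivAt_radialGaussian (m : ℕ) (y : ℝ) :
    HasDerivAt (radialGaussian m) (y ^ m * Real.exp (-y ^ 2 / 2)) y := by
  have hc : Continuous fun s : ℝ => s ^ m * Real.exp (-s ^ 2 / 2) := by fun_prop
  exact (hc.integral_hasStrictDerivAt 0 y).hasDerivAt

theorem hasDerivAt_radialGaussian_scale (m : ℕ) (R : ℝ) {v : ℝ} (hv : 0 < v) :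
    HasDerivAt (fun v : ℝ => radialGaussian m (R * v ^ (-1 / 2 : ℝ)))
      (-(R ^ (m + 1) / 2) * (v ^ (-((m : ℝ) + 3) / 2) * Real.exp (-R ^ 2 / (2 * v)))) v := by
  have h1 : (v ^ (-1 / 2 : ℝ)) ^ 2 = v⁻¹ := by
    rw [← rpow_natCast, ← rpow_mul hv.le, ← rpow_neg_one]; norm_num
  have h2 : v ^ (-((m : ℝ) + 3) / 2) = (v ^ (-1 / 2 : ℝ)) ^ m * v ^ (-1 / 2 - 1 : ℝ) := by
    rw [← rpow_natCast, ← rpow_mul hv.le, ← rpow_add hv]; congr 1; ring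
  have h3 : -R ^ 2 / (2 * v) = -(R * v ^ (-1 / 2 : ℝ)) ^ 2 / 2 := by
    rw [mul_pow, h1]; field_simp
  have h := (hasDerivAt_radialGaussian m (R * v ^ (-1 / 2 : ℝ))).comp v
    ((Real.hasDerivAt_rpow_const (p := (-1 / 2 : ℝ)) (Or.inl hv.ne')).const_mul R)
  refine h.congr_deriv ?_
  rw [h2, h3]
  ring

theorem hasDerivAt_deriv_radialGaussian_scale (m : ℕ) (R : ℝ) {v : ℝ} (hv : 0 < v) :
    HasDerivAt (fun v : ℝ =>
        -(R ^ (m + 1) / 2) * (v ^ (-((m : ℝ) + 3) / 2) * Real.exp (-R ^ 2 / (2 * v))))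
      (R ^ (m + 1) / 2 * (v ^ (-((m : ℝ) + 3) / 2) * Real.exp (-R ^ 2 / (2 * v))) *
        ((((m : ℝ) + 3) * v - R ^ 2) / (2 * v ^ 2))) v := by
  have he : HasDerivAt (fun v : ℝ => -R ^ 2 / (2 * v)) (R ^ 2 / (2 * v ^ 2)) v := by
    refine ((hasDerivAt_const v (-R ^ 2)).div ((hasDerivAt_id v).const_mul 2)
      (by simpa using hv.ne')).congr_deriv ?_
    simp only [id]
    field_simp
    ring
  have h := ((Real.hasDerivAt_rpow_const (p := (-((m : ℝ) + 3) / 2)) (Or.inl hv.ne')).mul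
    he.exp).const_mul (-(R ^ (m + 1) / 2))
  refine h.congr_deriv ?_
  rw [rpow_sub_one hv.ne']
  field_simp
  ring

theorem concaveOn_radialGaussian_scale (m : ℕ) {R : ℝ} (hR : 0 ≤ R) :
    ConcaveOn ℝ (Ioc 0 (R ^ 2 / ((m : ℝ) + 3)))
      (fun v : ℝ => radialGaussian m (R * v ^ (-1 / 2 : ℝ))) := by
  refine concaveOn_of_hasDerivWithinAt2_nonpos (convex_Ioc _ _)
    (fun v hv => (hasDerivAt_radialGaussian_scale m R hv.1).continuousAt.continuousWithinAt)
    (fun v hv => (hasDerivAt_radialGaussian_scale m R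
      (interior_subset hv).1).hasDerivWithinAt)
    (fun v hv => (hasDerivAt_deriv_radialGaussian_scale m R
      (interior_subset hv).1).hasDerivWithinAt) fun v hv => ?_
  obtain ⟨h0, h1⟩ := interior_subset hv
  rw [le_div_iff₀ (by positivity)] at h1
  exact mul_nonpos_of_nonneg_of_nonpos (by positivity)
    (div_nonpos_of_nonpos_of_nonneg (by linarith) (by positivity))

theorem convexOn_radialGaussian_scale (m : ℕ) {R a : ℝ} (hR : 0 ≤ R) (ha : 0 < a)
    (hRa : R ^ 2 / ((m : ℝ) + 3) ≤ a) :
    ConvexOn ℝ (Ici a) (fun v : ℝ => radialGaussian m (R * v ^ (-1 / 2 : ℝ))) := by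
  have hpos : ∀ {v}, v ∈ Ici a → 0 < v := fun hv => ha.trans_le hv
  refine convexOn_of_hasDerivWithinAt2_nonneg (convex_Ici _)
    (fun v hv => (hasDerivAt_radialGaussian_scale m R
      (hpos hv)).continuousAt.continuousWithinAt)
    (fun v hv => (hasDerivAt_radialGaussian_scale m R
      (hpos (interior_subset hv))).hasDerivWithinAt)
    (fun v hv => (hasDerivAt_deriv_radialGaussian_scale m R
      (hpos (interior_subset hv))).hasDerivWithinAt) fun v hv => ?_
  have h1 : a ≤ v := interior_subset hv
  have h0 := hpos (interior_subset hv)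
  have h2 := hRa.trans h1
  rw [div_le_iff₀ (by positivity)] at h2
  exact mul_nonneg (by positivity) (div_nonneg (by linarith) (by positivity))

theorem Ioc_ae_eq_of_initial {S : Set ℝ} (hS : S ⊆ Ioi 0) (hbdd : BddAbove S)
    (hdown : ∀ r ∈ S, ∀ t, 0 < t → t ≤ r → t ∈ S) : S =ᵐ[volume] Ioc 0 (sSup S) := by
  refine Filter.EventuallyLE.antisymm
    (LE.le.eventuallyLE fun r hr => ⟨hS hr, le_csSup hbdd hr⟩) ?_
  refine Ioo_ae_eq_Ioc.symm.le.trans (LE.le.eventuallyLE fun r hr => ?_)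
  rcases S.eq_empty_or_nonempty with rfl | hne
  · simp at hr
  · obtain ⟨t, ht, hrt⟩ := exists_lt_of_lt_csSup hne hr.2
    exact hdown t ht r hr.1 hrt.le

theorem concaveOn_integral_ray {m : ℕ} {S : Set ℝ} {d : ℝ} (hd : 0 < d) (hS : S ⊆ Ioi 0)
    (hdown : ∀ r ∈ S, ∀ t, 0 < t → t ≤ r → t ∈ S) (hdS : d ∈ S) :
    ConcaveOn ℝ (Ioc 0 (d ^ 2 / ((m : ℝ) + 3)))
      (fun v => ∫ r in S, r ^ m * gaussianProfile (m + 1) v r) := by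
  by_cases hbdd : BddAbove S
  · have hdR : d ≤ sSup S := le_csSup hbdd hdS
    have hR : 0 ≤ sSup S := hd.le.trans hdR
    refine (((concaveOn_radialGaussian_scale m hR).subset
      (Ioc_subset_Ioc_right (by gcongr)) (convex_Ioc _ _)).smul
      (c := (2 * π) ^ (-((m + 1 : ℕ) : ℝ) / 2)) (by positivity)).congr fun v hv => ?_
    simp only [smul_eq_mul]
    rw [setIntegral_congr_set (Ioc_ae_eq_of_initial hS hbdd hdown),
      integral_Ioc_gaussianProfile hv.1 hR]
  · have hS' : S = Ioi 0 := hS.antisymm fun t ht => by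
      obtain ⟨r, hr, htr⟩ := not_bddAbove_iff.1 hbdd t
      exact hdown r hr t ht htr.le
    refine (concaveOn_const ((2 * π) ^ (-((m + 1 : ℕ) : ℝ) / 2) *
      ∫ s in Ioi (0 : ℝ), s ^ m * Real.exp (-s ^ 2 / 2)) (convex_Ioc _ _)).congr fun v hv => ?_
    rw [hS', integral_Ioi_gaussianProfile hv.1]

theorem convexOn_integral_ray {m : ℕ} {S : Set ℝ} {d : ℝ} (hd : 0 < d) (hS : S ⊆ Ioc 0 d)
    (hdown : ∀ r ∈ S, ∀ t, 0 < t → t ≤ r → t ∈ S) :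
    ConvexOn ℝ (Ici (d ^ 2 / ((m : ℝ) + 3)))
      (fun v => ∫ r in S, r ^ m * gaussianProfile (m + 1) v r) := by
  have ha : 0 < d ^ 2 / ((m : ℝ) + 3) := by positivity
  have hbdd : BddAbove S := ⟨d, fun r hr => (hS hr).2⟩
  have hR : 0 ≤ sSup S := Real.sSup_nonneg fun r hr => (hS hr).1.le
  have hRd : sSup S ≤ d := Real.sSup_le (fun r hr => (hS hr).2) hd.le
  refine ((convexOn_radialGaussian_scale m hR ha (by gcongr)).smul
    (c := (2 * π) ^ (-((m + 1 : ℕ) : ℝ) / 2)) (by positivity)).congr fun v hv => ?_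
  simp only [smul_eq_mul]
  rw [setIntegral_congr_set (Ioc_ae_eq_of_initial (fun r hr => (hS hr).1) hbdd hdown),
    integral_Ioc_gaussianProfile (ha.trans_le hv) hR]

theorem integrable_gaussianProfile_norm {m : ℕ} {v : ℝ} (hv : 0 < v) :
    Integrable (fun x : EuclideanSpace ℝ (Fin (m + 1)) => gaussianProfile (m + 1) v ‖x‖) := by
  rw [integrable_fun_norm_addHaar]
  have h := (integrableOn_rpow_mul_exp_neg_mul_sq (b := 1 / (2 * v)) (by positivity)
    (s := m) (by linarith [m.cast_nonneg (α := ℝ)])).const_mul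
      ((2 * π * v) ^ (-((m + 1 : ℕ) : ℝ) / 2))
  refine h.congr (.of_forall fun r => ?_)
  simp only [finrank_euclideanSpace, Fintype.card_fin, Nat.add_sub_cancel, smul_eq_mul,
    rpow_natCast, gaussianProfile]
  rw [show -(1 / (2 * v)) * r ^ 2 = -r ^ 2 / (2 * v) by ring]
  ring

section Region

variable {m : ℕ} {Ω : Set (EuclideanSpace ℝ (Fin (m + 1)))}

/-- The radii at which the ray in direction `θ` meets `Ω`. -/
def raySection (Ω : Set (EuclideanSpace ℝ (Fin (m + 1))))
    (θ : EuclideanSpace ℝ (Fin (m + 1))) : Set ℝ :=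
  Ioi 0 ∩ {r | r • θ ∈ Ω}

theorem raySection_initial (hΩ : StarConvex ℝ 0 Ω) (θ : EuclideanSpace ℝ (Fin (m + 1))) :
    ∀ r ∈ raySection Ω θ, ∀ t, 0 < t → t ≤ r → t ∈ raySection Ω θ := by
  rintro r ⟨hr, hrΩ⟩ t ht htr
  refine ⟨ht, ?_⟩
  have hr' : r ≠ 0 := (mem_Ioi.1 hr).ne'
  have h := hΩ.smul_mem hrΩ (div_nonneg ht.le hr.le) ((div_le_one hr).2 htr)
  rwa [smul_smul, div_mul_cancel₀ _ hr'] at h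

theorem integral_ray_indicator (hΩ : MeasurableSet Ω) (v : ℝ)
    (θ : Metric.sphere (0 : EuclideanSpace ℝ (Fin (m + 1))) 1) :
    ∫ r in Ioi (0 : ℝ), r ^ (Module.finrank ℝ (EuclideanSpace ℝ (Fin (m + 1))) - 1) *
        Ω.indicator (fun x => gaussianProfile (m + 1) v ‖x‖) (r • θ.1) =
      ∫ r in raySection Ω θ.1, r ^ m * gaussianProfile (m + 1) v r := by
  have hmeas : MeasurableSet {r : ℝ | r • θ.1 ∈ Ω} :=
    hΩ.preimage (by fun_prop : Measurable fun r : ℝ => r • θ.1)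
  rw [raySection, ← setIntegral_indicator hmeas]
  refine setIntegral_congr_fun measurableSet_Ioi fun r hr => ?_
  have hn : ‖r • θ.1‖ = r := by simp [norm_smul, abs_of_pos (mem_Ioi.1 hr)]
  by_cases h : r • θ.1 ∈ Ω <;> simp [indicator, h, hn]

theorem setIntegral_gaussianProfile_norm (hΩ : MeasurableSet Ω) {v : ℝ} (hv : 0 < v) :
    ∫ x in Ω, gaussianProfile (m + 1) v ‖x‖ =
      ∫ θ : Metric.sphere (0 : EuclideanSpace ℝ (Fin (m + 1))) 1,
        (∫ r in raySection Ω θ.1, r ^ m * gaussianProfile (m + 1) v r) ∂volume.toSphere := by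
  rw [← integral_indicator hΩ,
    integral_polar volume ((integrable_gaussianProfile_norm hv).indicator hΩ)]
  simp_rw [integral_ray_indicator hΩ]

theorem integrable_integral_raySection (hΩ : MeasurableSet Ω) {v : ℝ} (hv : 0 < v) :
    Integrable (fun θ : Metric.sphere (0 : EuclideanSpace ℝ (Fin (m + 1))) 1 =>
      ∫ r in raySection Ω θ.1, r ^ m * gaussianProfile (m + 1) v r) volume.toSphere := by
  simpa only [integral_ray_indicator hΩ] using
    integrable_integral_ray volume ((integrable_gaussianProfile_norm hv).indicator hΩ)

theorem concaveOn_setIntegral_gaussianProfile_norm (hmeas : MeasurableSet Ω)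
    (hstar : StarConvex ℝ 0 Ω) {d : ℝ} (hd : 0 < d) (hball : Metric.closedBall 0 d ⊆ Ω) :
    ConcaveOn ℝ (Ioc 0 (d ^ 2 / ((m : ℝ) + 3)))
      (fun v => ∫ x in Ω, gaussianProfile (m + 1) v ‖x‖) := by
  refine (ConcaveOn.integral_param (μ := volume.toSphere) (convex_Ioc _ _)
    (fun θ : Metric.sphere (0 : EuclideanSpace ℝ (Fin (m + 1))) 1 =>
      concaveOn_integral_ray hd inter_subset_left (raySection_initial hstar θ.1) ⟨hd, hball ?_⟩)
    fun v hv => integrable_integral_raySection hmeas hv.1).congr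
      fun v hv => (setIntegral_gaussianProfile_norm hmeas hv.1).symm
  simp [norm_smul, abs_of_pos hd]

theorem convexOn_setIntegral_gaussianProfile_norm (hmeas : MeasurableSet Ω)
    (hstar : StarConvex ℝ 0 Ω) {d : ℝ} (hd : 0 < d) (hball : Ω ⊆ Metric.closedBall 0 d) :
    ConvexOn ℝ (Ici (d ^ 2 / ((m : ℝ) + 3)))
      (fun v => ∫ x in Ω, gaussianProfile (m + 1) v ‖x‖) := by
  have ha : 0 < d ^ 2 / ((m : ℝ) + 3) := by positivity
  refine (ConvexOn.integral_param (μ := volume.toSphere) (convex_Ici _)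
    (fun θ : Metric.sphere (0 : EuclideanSpace ℝ (Fin (m + 1))) 1 =>
      convexOn_integral_ray hd (fun r hr => ⟨hr.1, ?_⟩) (raySection_initial hstar θ.1))
    fun v hv => integrable_integral_raySection hmeas (ha.trans_le hv)).congr
      fun v hv => (setIntegral_gaussianProfile_norm hmeas (ha.trans_le hv)).symm
  simpa [norm_smul, abs_of_pos (mem_Ioi.1 hr.1)] using hball hr.2

end Region

/-- In the AWGN channel, the SER of a decoder with center-convex
decision regions, as a function of the noise power `v`, is convex on
`(0, d_min²/(n+2)]` when the regions contain the `d_min`-ball, and concave on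
`[d_max²/(n+2), ∞)` when the regions are contained in the `d_max`-ball. -/
theorem ser_convexity_in_noise_power_awgn
    (n M : ℕ) (hn : 1 ≤ n)
    (q : Fin M → ℝ) (hq : ∀ i, 0 ≤ q i) (hqsum : ∑ i, q i = 1)
    (Ω : Fin M → Set (EuclideanSpace ℝ (Fin n)))
    (hΩmeas : ∀ i, MeasurableSet (Ω i))
    (hΩstar : ∀ i, StarConvex ℝ (0 : EuclideanSpace ℝ (Fin n)) (Ω i))
    (Pe : ℝ → ℝ)
    (hPe : ∀ v, Pe v = 1 - ∑ i, q i * ∫ x in Ω i,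
      (2 * π * v) ^ (-(n : ℝ) / 2) * Real.exp (-‖x‖ ^ 2 / (2 * v))) :
    (∀ dmin : ℝ, 0 < dmin →
      (∀ i, Metric.closedBall (0 : EuclideanSpace ℝ (Fin n)) dmin ⊆ Ω i) →
      ConvexOn ℝ (Ioc (0 : ℝ) (dmin ^ 2 / ((n : ℝ) + 2))) Pe) ∧
    (∀ dmax : ℝ, 0 < dmax →
      (∀ i, Ω i ⊆ Metric.closedBall (0 : EuclideanSpace ℝ (Fin n)) dmax) →
      ConcaveOn ℝ (Ici (dmax ^ 2 / ((n : ℝ) + 2))) Pe) := by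
  obtain ⟨m, rfl⟩ : ∃ m, n = m + 1 := ⟨n - 1, by omega⟩
  have hm : (((m + 1 : ℕ) : ℝ) + 2) = (m : ℝ) + 3 := by push_cast; ring
  obtain rfl : Pe = fun v => 1 - ∑ i, q i * ∫ x in Ω i, gaussianProfile (m + 1) v ‖x‖ :=
    funext hPe
  rw [hm]
  refine ⟨fun d hd hball => (convexOn_const 1 (convex_Ioc _ _)).sub ?_,
    fun d hd hball => (concaveOn_const 1 (convex_Ici _)).sub ?_⟩
  · have h := Finset.sum_induction (s := Finset.univ)
      (fun i v => q i * ∫ x in Ω i, gaussianProfile (m + 1) v ‖x‖)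
      (ConcaveOn ℝ (Ioc 0 (d ^ 2 / ((m : ℝ) + 3)))) (fun _ _ => ConcaveOn.add)
      (concaveOn_const 0 (convex_Ioc _ _)) fun i _ =>
        (concaveOn_setIntegral_gaussianProfile_norm (hΩmeas i) (hΩstar i) hd (hball i)).smul (hq i)
    simpa only [Finset.sum_fn] using h
  · have h := Finset.sum_induction (s := Finset.univ)
      (fun i v => q i * ∫ x in Ω i, gaussianProfile (m + 1) v ‖x‖)
      (ConvexOn ℝ (Ici (d ^ 2 / ((m : ℝ) + 3)))) (fun _ _ => ConvexOn.add)
      (convexOn_const 0 (convex_Ici _)) fun i _ =>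
        (convexOn_setIntegral_gaussianProfile_norm (hΩmeas i) (hΩstar i) hd (hball i)).smul (hq i)
    simpa only [Finset.sum_fn] using h
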